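/- Let Ω ⊂⊂ ℂⁿ be a bounded pseudoconvex domain with C^k (k ≥ 3)-smooth boundary, ρ a defining function of Ω, and α = α_ρ the D'Angelo 1-form of ρ. Then (dα)_p(X,Y) = 0 for every p ∈ ∂Ω and all X, Y ∈ Null_p ⊕ conj(Null_p), where Null_p is the null space of the Levi form of ρ in T^{1,0}_p(∂Ω). -/

import Mathlib

open Complex
open scoped ComplexOrder

noncomputable section

/-- Points of ℂⁿ. -/
abbrev Pt (n : ℕ) := Fin n → ℂ

/-- Wirtinger derivative ∂f/∂z_j at z (junk value if f is not differentiable). -/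
def dZ (n : ℕ) (f : Pt n → ℂ) (j : Fin n) (z : Pt n) : ℂ :=
  (1 / 2 : ℂ) * (fderiv ℝ f z (Pi.single j 1) - Complex.I * fderiv ℝ f z (Pi.single j Complex.I))

/-- Wirtinger derivative ∂f/∂z̄_j at z. -/
def dZb (n : ℕ) (f : Pt n → ℂ) (j : Fin n) (z : Pt n) : ℂ :=
  (1 / 2 : ℂ) * (fderiv ℝ f z (Pi.single j 1) + Complex.I * fderiv ℝ f z (Pi.single j Complex.I))

/-- Complexification of a real-valued function. -/
def cR (n : ℕ) (ρ : Pt n → ℝ) : Pt n → ℂ := fun z => (ρ z : ℂ)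

/-- Levi form of ρ at z: Levi_ρ(X,Y) = Σ_{j,k} ∂²ρ/∂z_j∂z̄_k X_j conj(Y_k), where X, Y are
(1,0)-vectors given by their coefficient tuples. -/
def levi (n : ℕ) (ρ : Pt n → ℝ) (z : Pt n) (X Y : Fin n → ℂ) : ℂ :=
  ∑ j, ∑ k, dZ n (fun w => dZb n (cR n ρ) k w) j z * X j * (starRingEnd ℂ) (Y k)

/-- Holomorphic tangent space T^{1,0}_p(∂Ω) (for boundary points p), described via a defining
function: (1,0)-vectors X with Σ_j X_j ∂ρ/∂z_j(p) = 0. -/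
def T10 (n : ℕ) (ρ : Pt n → ℝ) (p : Pt n) : Set (Fin n → ℂ) :=
  {X | ∑ j, X j * dZ n (cR n ρ) j p = 0}

/-- Null space of the Levi form inside T^{1,0}_p(∂Ω). -/
def nullSp (n : ℕ) (ρ : Pt n → ℝ) (p : Pt n) : Set (Fin n → ℂ) :=
  {X | X ∈ T10 n ρ p ∧ ∀ Y ∈ T10 n ρ p, levi n ρ p X Y = 0}

/-- ρ is a C^s defining function of Ω on the neighborhood V of the closure of Ω. -/
def IsDefining (n : ℕ) (s : ℕ∞) (Ω : Set (Pt n)) (ρ : Pt n → ℝ) (V : Set (Pt n)) : Prop :=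
  IsOpen V ∧ closure Ω ⊆ V ∧ ContDiffOn ℝ s ρ V ∧
    Ω = {z | z ∈ V ∧ ρ z < 0} ∧ ∀ z ∈ frontier Ω, fderiv ℝ ρ z ≠ 0

/-- Strict plurisubharmonicity on a set, via positivity of the Levi form. -/
def StrictPSHOn (n : ℕ) (f : Pt n → ℝ) (s : Set (Pt n)) : Prop :=
  ∀ z ∈ s, ∀ X : Fin n → ℂ, X ≠ 0 → 0 < (levi n f z X X).re

/-- Diederich–Fornaess exponent of a defining function ρ (0 if the defining set is empty). -/
def DFexp (n : ℕ) (ρ : Pt n → ℝ) (Ω : Set (Pt n)) : ℝ :=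
  sSup {η : ℝ | 0 < η ∧ η < 1 ∧ StrictPSHOn n (fun z => -((-ρ z) ^ η)) Ω}

/-- Diederich–Fornaess index of Ω: supremum over all (C¹) defining functions. -/
def DFindex (n : ℕ) (Ω : Set (Pt n)) : ℝ :=
  sSup {e : ℝ | ∃ ρ V, IsDefining n 1 Ω ρ V ∧ e = DFexp n ρ Ω}

/-- Steinness exponent of a defining function ρ (⊤ = ∞ if the defining set is empty). -/
def Sexp (n : ℕ) (ρ : Pt n → ℝ) (Ω : Set (Pt n)) : EReal :=
  sInf {e : EReal | ∃ η : ℝ, 1 < η ∧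
    (∃ U : Set (Pt n), IsOpen U ∧ frontier Ω ⊆ U ∧
      StrictPSHOn n (fun z => ρ z ^ η) ((closure Ω)ᶜ ∩ U)) ∧ e = (η : EReal)}

/-- Steinness index of Ω: infimum over all (C¹) defining functions. -/
def Sindex (n : ℕ) (Ω : Set (Pt n)) : EReal :=
  sInf {e : EReal | ∃ ρ V, IsDefining n 1 Ω ρ V ∧ e = Sexp n ρ Ω}

/-- A complex vector field Σ_j a_j ∂/∂z_j + Σ_j b_j ∂/∂z̄_j on ℂⁿ, recorded by its
coefficient functions. -/
structure VF (n : ℕ) where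
  a : Pt n → Fin n → ℂ
  b : Pt n → Fin n → ℂ

/-- Action of a complex vector field on a function. -/
def VF.app {n : ℕ} (V : VF n) (f : Pt n → ℂ) (z : Pt n) : ℂ :=
  ∑ j, V.a z j * dZ n f j z + ∑ j, V.b z j * dZb n f j z

/-- The value of a vector field at a point, as a pair ((1,0)-part, (0,1)-part). -/
def VF.atPt {n : ℕ} (V : VF n) (p : Pt n) : (Fin n → ℂ) × (Fin n → ℂ) := (V.a p, V.b p)

/-- A complex 1-form Σ_j w_j dz_j + Σ_j t_j dz̄_j on ℂⁿ. -/
structure Form1 (n : ℕ) where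
  w : Pt n → Fin n → ℂ
  t : Pt n → Fin n → ℂ

/-- Value of a 1-form at a point on a complex tangent vector (pair of (1,0) and (0,1) parts). -/
def Form1.eval {n : ℕ} (η : Form1 n) (z : Pt n) (X : (Fin n → ℂ) × (Fin n → ℂ)) : ℂ :=
  ∑ j, η.w z j * X.1 j + ∑ j, η.t z j * X.2 j

/-- Pairing of a 1-form with a vector field. -/
def Form1.app {n : ℕ} (η : Form1 n) (V : VF n) (z : Pt n) : ℂ :=
  η.eval z (V.atPt z)

/-- Lie bracket of complex vector fields. -/
def VF.bracket {n : ℕ} (V W : VF n) : VF n :=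
  ⟨fun z j => V.app (fun w => W.a w j) z - W.app (fun w => V.a w j) z,
   fun z j => V.app (fun w => W.b w j) z - W.app (fun w => V.b w j) z⟩

/-- Levi-Civita covariant derivative ∇_V W of the Euclidean metric (componentwise derivative). -/
def covD {n : ℕ} (V W : VF n) : VF n :=
  ⟨fun z j => V.app (fun w => W.a w j) z, fun z j => V.app (fun w => W.b w j) z⟩

/-- Lie derivative of a 1-form along a vector field, in coordinates. -/
def lieD {n : ℕ} (T : VF n) (η : Form1 n) : Form1 n :=
  ⟨fun z j => T.app (fun w => η.w w j) z + ∑ m, η.w z m * dZ n (fun w => T.a w m) j z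
      + ∑ m, η.t z m * dZ n (fun w => T.b w m) j z,
   fun z j => T.app (fun w => η.t w j) z + ∑ m, η.w z m * dZb n (fun w => T.a w m) j z
      + ∑ m, η.t z m * dZb n (fun w => T.b w m) j z⟩

/-- Negation of a 1-form. -/
def Form1.neg {n : ℕ} (η : Form1 n) : Form1 n := ⟨fun z j => -η.w z j, fun z j => -η.t z j⟩

/-- Σ_j |∂ρ/∂z_j|². -/
def gradSq (n : ℕ) (ρ : Pt n → ℝ) (z : Pt n) : ℝ :=
  ∑ j, Complex.normSq (dZ n (cR n ρ) j z)

/-- Norm of the real gradient of ρ: ‖∇ρ‖ = 2 (Σ_j |∂ρ/∂z_j|²)^{1/2}. -/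
def gradNorm (n : ℕ) (ρ : Pt n → ℝ) (z : Pt n) : ℝ := 2 * Real.sqrt (gradSq n ρ z)

/-- The (1,0) field L_n = (Σ|∂ρ/∂z_j|²)⁻¹ Σ_j (∂ρ/∂z̄_j) ∂/∂z_j. -/
def LnVF (n : ℕ) (ρ : Pt n → ℝ) : VF n :=
  ⟨fun z j => dZb n (cR n ρ) j z / (gradSq n ρ z : ℂ), fun _ _ => 0⟩

/-- The (1,0) field N = (Σ|∂ρ/∂z_j|²)^{-1/2} Σ_j (∂ρ/∂z̄_j) ∂/∂z_j. -/
def NVF (n : ℕ) (ρ : Pt n → ℝ) : VF n :=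
  ⟨fun z j => dZb n (cR n ρ) j z / ((Real.sqrt (gradSq n ρ z) : ℝ) : ℂ), fun _ _ => 0⟩

/-- T = L_n − conj(L_n). -/
def TVF (n : ℕ) (ρ : Pt n → ℝ) : VF n :=
  ⟨fun z j => (LnVF n ρ).a z j, fun z j => -(starRingEnd ℂ) ((LnVF n ρ).a z j)⟩

/-- η = (1/2)(∂ρ − ∂̄ρ). -/
def etaF (n : ℕ) (ρ : Pt n → ℝ) : Form1 n :=
  ⟨fun z j => (1 / 2 : ℂ) * dZ n (cR n ρ) j z,
   fun z j => -(1 / 2 : ℂ) * dZb n (cR n ρ) j z⟩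

/-- The D'Angelo 1-form α_ρ = −Lie_T η of a defining function ρ. -/
def dAngelo (n : ℕ) (ρ : Pt n → ℝ) : Form1 n := Form1.neg (lieD (TVF n ρ) (etaF n ρ))

/-- Evaluation of the (1,0)-part ∂η of the exterior derivative of a 1-form on two
complex tangent vectors. -/
def delEval {n : ℕ} (η : Form1 n) (X Y : (Fin n → ℂ) × (Fin n → ℂ)) (z : Pt n) : ℂ :=
  (∑ m, ∑ l, dZ n (fun w => η.w w l) m z * (X.1 m * Y.1 l - Y.1 m * X.1 l)) +
  (∑ m, ∑ l, dZ n (fun w => η.t w l) m z * (X.1 m * Y.2 l - Y.1 m * X.2 l))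

/-- Evaluation of ∂̄η of a 1-form η on two complex tangent vectors. -/
def delbEval {n : ℕ} (η : Form1 n) (X Y : (Fin n → ℂ) × (Fin n → ℂ)) (z : Pt n) : ℂ :=
  (∑ m, ∑ l, dZb n (fun w => η.w w l) m z * (X.2 m * Y.1 l - Y.2 m * X.1 l)) +
  (∑ m, ∑ l, dZb n (fun w => η.t w l) m z * (X.2 m * Y.2 l - Y.2 m * X.2 l))

/-- Evaluation of dη = ∂η + ∂̄η. -/
def dEval {n : ℕ} (η : Form1 n) (X Y : (Fin n → ℂ) × (Fin n → ℂ)) (z : Pt n) : ℂ :=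
  delEval η X Y z + delbEval η X Y z

/-- Evaluation of d^c η = i(∂̄ − ∂)η. -/
def dcEval {n : ℕ} (η : Form1 n) (X Y : (Fin n → ℂ) × (Fin n → ℂ)) (z : Pt n) : ℂ :=
  Complex.I * (delbEval η X Y z - delEval η X Y z)

/-- Evaluation of ω ∧ ω̄ on two complex tangent vectors, where ω = π_{1,0} η is the
(1,0)-component of the real 1-form η. -/
def omegaWedge {n : ℕ} (η : Form1 n) (X Y : (Fin n → ℂ) × (Fin n → ℂ)) (z : Pt n) : ℂ :=
  (∑ j, η.w z j * X.1 j) * (∑ j, (starRingEnd ℂ) (η.w z j) * Y.2 j) -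
  (∑ j, η.w z j * Y.1 j) * (∑ j, (starRingEnd ℂ) (η.w z j) * X.2 j)

/-- Evaluation of ∂̄ω where ω = π_{1,0} η. -/
def delbOmega {n : ℕ} (η : Form1 n) (X Y : (Fin n → ℂ) × (Fin n → ℂ)) (z : Pt n) : ℂ :=
  delbEval ⟨η.w, fun _ _ => 0⟩ X Y z

/-- The standard Euclidean complex Hermitian metric g on complexified tangent vectors
(so that g(∂/∂z_j, ∂/∂z_j) = 1/2). -/
def gMet {n : ℕ} (X Y : (Fin n → ℂ) × (Fin n → ℂ)) : ℂ :=
  (1 / 2 : ℂ) * (∑ j, X.1 j * (starRingEnd ℂ) (Y.1 j) + ∑ j, X.2 j * (starRingEnd ℂ) (Y.2 j))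

/-- The real gradient ∇ρ as a complex vector field: 2Σ_j (∂ρ/∂z̄_j ∂/∂z_j + ∂ρ/∂z_j ∂/∂z̄_j). -/
def gradVF (n : ℕ) (ρ : Pt n → ℝ) : VF n :=
  ⟨fun z j => 2 * dZb n (cR n ρ) j z, fun z j => 2 * dZ n (cR n ρ) j z⟩

/-- Pseudoconvexity of Ω (w.r.t. the defining function ρ): the Levi form is positive
semidefinite on the holomorphic tangent spaces of the boundary. -/
def LeviPseudoconvex (n : ℕ) (ρ : Pt n → ℝ) (Ω : Set (Pt n)) : Prop :=
  ∀ p ∈ frontier Ω, ∀ X ∈ T10 n ρ p, 0 ≤ (levi n ρ p X X).re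

/-- The set Σ of weakly pseudoconvex boundary points. -/
def weakPts (n : ℕ) (ρ : Pt n → ℝ) (Ω : Set (Pt n)) : Set (Pt n) :=
  {p | p ∈ frontier Ω ∧ ∃ X ∈ T10 n ρ p, X ≠ 0 ∧ levi n ρ p X X = 0}

/-- Action of a complex tangent vector at p on a function. -/
def vecApp (n : ℕ) (X : (Fin n → ℂ) × (Fin n → ℂ)) (f : Pt n → ℂ) (p : Pt n) : ℂ :=
  ∑ j, X.1 j * dZ n f j p + ∑ j, X.2 j * dZb n f j p

/-- Pushforward (complexified differential) of a complex tangent vector at p by a map f. -/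
def push (n : ℕ) (f : Pt n → Pt n) (p : Pt n) (X : (Fin n → ℂ) × (Fin n → ℂ)) :
    (Fin n → ℂ) × (Fin n → ℂ) :=
  (fun l => vecApp n X (fun w => f w l) p,
   fun l => vecApp n X (fun w => (starRingEnd ℂ) (f w l)) p)

/-- Conjugation of a coefficient tuple. -/
def conjVec {n : ℕ} (X : Fin n → ℂ) : Fin n → ℂ := fun j => (starRingEnd ℂ) (X j)

/-- A C^k CR-diffeomorphism between ∂Ω₁ and ∂Ω₂, presented by a C^k map f on a
neighborhood U₁ of ∂Ω₁ together with a C^k local inverse g: f maps ∂Ω₁ onto ∂Ω₂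
diffeomorphically and its differential maps T^{1,0}(∂Ω₁) into T^{1,0}(∂Ω₂). -/
def IsCRDiffeo (n : ℕ) (k : ℕ∞) (Ω₁ Ω₂ : Set (Pt n)) (ρ₁ ρ₂ : Pt n → ℝ)
    (f g : Pt n → Pt n) (U₁ U₂ : Set (Pt n)) : Prop :=
  IsOpen U₁ ∧ IsOpen U₂ ∧ frontier Ω₁ ⊆ U₁ ∧ frontier Ω₂ ⊆ U₂ ∧
  (∀ l, ContDiffOn ℝ k (fun z => f z l) U₁) ∧
  (∀ l, ContDiffOn ℝ k (fun z => g z l) U₂) ∧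
  f '' frontier Ω₁ = frontier Ω₂ ∧
  (∀ p ∈ frontier Ω₁, g (f p) = p) ∧ (∀ q ∈ frontier Ω₂, f (g q) = q) ∧
  (∀ p ∈ frontier Ω₁, ∀ L ∈ T10 n ρ₁ p,
    (push n f p (L, 0)).2 = 0 ∧ (push n f p (L, 0)).1 ∈ T10 n ρ₂ (f p))

/-- The 1-form d^c ψ = i(∂̄ψ − ∂ψ) of a real function ψ. -/
def dcForm (n : ℕ) (ψ : Pt n → ℝ) : Form1 n :=
  ⟨fun z j => -Complex.I * dZ n (cR n ψ) j z, fun z j => Complex.I * dZb n (cR n ψ) j z⟩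

end

lemma fderiv_apply_eq_sum {n : ℕ} (A : Pt n →L[ℝ] ℂ) (x : Pt n) :
    A x = ∑ j, (((x j).re : ℂ) * A (Pi.single j 1) + ((x j).im : ℂ) * A (Pi.single j I)) := by
  have hx : x = ∑ j, ((x j).re • (Pi.single j 1 : Pt n) + (x j).im • (Pi.single j I : Pt n)) := by
    ext i
    simp [Finset.sum_apply, Finset.sum_add_distrib, Pi.single_apply]
  conv_lhs => rw [hx]
  simp [map_sum]

/-- The real part of the direction of differentiation encoded by a complex tangent vector. -/
noncomputable def reDir {n : ℕ} (X : (Fin n → ℂ) × (Fin n → ℂ)) : Pt n :=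
  fun j => (1 / 2 : ℂ) * (X.1 j + (starRingEnd ℂ) (X.2 j))

/-- The imaginary part of the direction of differentiation encoded by a complex tangent vector. -/
noncomputable def imDir {n : ℕ} (X : (Fin n → ℂ) × (Fin n → ℂ)) : Pt n :=
  fun j => (1 / 2 : ℂ) * I * ((starRingEnd ℂ) (X.2 j) - X.1 j)

lemma vecApp_eq_fderiv {n : ℕ} (X : (Fin n → ℂ) × (Fin n → ℂ)) (f : Pt n → ℂ) (z : Pt n) :
    vecApp n X f z = fderiv ℝ f z (reDir X) + I * fderiv ℝ f z (imDir X) := by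
  rw [fderiv_apply_eq_sum _ (reDir X), fderiv_apply_eq_sum _ (imDir X), Finset.mul_sum,
    ← Finset.sum_add_distrib, vecApp, ← Finset.sum_add_distrib]
  refine Finset.sum_congr rfl fun j _ => ?_
  have h1 := re_add_im (X.1 j)
  have h2 := re_add_im (X.2 j)
  simp only [dZ, dZb, reDir, imDir]
  generalize fderiv ℝ f z (Pi.single j 1) = u
  generalize fderiv ℝ f z (Pi.single j I) = v
  rw [← h1, ← h2]
  apply Complex.ext <;> simp <;> ring

lemma dZ_eq_vecApp {n : ℕ} (f : Pt n → ℂ) (j : Fin n) (z : Pt n) :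
    dZ n f j z = vecApp n (Pi.single j 1, 0) f z := by
  simp [vecApp, Pi.single_apply]

lemma dZb_eq_vecApp {n : ℕ} (f : Pt n → ℂ) (j : Fin n) (z : Pt n) :
    dZb n f j z = vecApp n (0, Pi.single j 1) f z := by
  simp [vecApp, Pi.single_apply]

lemma vecApp_congr {n : ℕ} (X : (Fin n → ℂ) × (Fin n → ℂ)) {f g : Pt n → ℂ} {z : Pt n}
    (h : f =ᶠ[nhds z] g) : vecApp n X f z = vecApp n X g z := by
  simp only [vecApp_eq_fderiv, h.fderiv_eq]

lemma vecApp_const {n : ℕ} (X : (Fin n → ℂ) × (Fin n → ℂ)) (c : ℂ) (z : Pt n) :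
    vecApp n X (fun _ => c) z = 0 := by
  simp [vecApp_eq_fderiv]

lemma vecApp_mul {n : ℕ} (X : (Fin n → ℂ) × (Fin n → ℂ)) {f g : Pt n → ℂ} {z : Pt n}
    (hf : DifferentiableAt ℝ f z) (hg : DifferentiableAt ℝ g z) :
    vecApp n X (fun w => f w * g w) z = vecApp n X f z * g z + f z * vecApp n X g z := by
  simp only [vecApp_eq_fderiv, fderiv_fun_mul hf hg]
  simp
  ring

lemma vecApp_sum {n : ℕ} {ι : Type*} [Fintype ι] (X : (Fin n → ℂ) × (Fin n → ℂ))
    {f : ι → Pt n → ℂ} {z : Pt n} (hf : ∀ r, DifferentiableAt ℝ (f r) z) :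
    vecApp n X (fun w => ∑ r, f r w) z = ∑ r, vecApp n X (f r) z := by
  simp only [vecApp_eq_fderiv, fderiv_fun_sum fun r _ => hf r]
  simp [Finset.sum_add_distrib, Finset.mul_sum]

lemma vecApp_sum_mul {n : ℕ} {ι : Type*} [Fintype ι] (X : (Fin n → ℂ) × (Fin n → ℂ))
    {f g : ι → Pt n → ℂ} {z : Pt n} (hf : ∀ r, DifferentiableAt ℝ (f r) z)
    (hg : ∀ r, DifferentiableAt ℝ (g r) z) :
    vecApp n X (fun w => ∑ r, f r w * g r w) z =
      ∑ r, vecApp n X (f r) z * g r z + ∑ r, f r z * vecApp n X (g r) z := by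
  rw [vecApp_sum (f := fun r w => f r w * g r w) X fun r => (hf r).mul (hg r), ← Finset.sum_add_distrib]
  exact Finset.sum_congr rfl fun r _ => vecApp_mul X (hf r) (hg r)

lemma vecApp_conj {n : ℕ} (X : (Fin n → ℂ) × (Fin n → ℂ)) (f : Pt n → ℂ) (z : Pt n) :
    vecApp n X (fun w => (starRingEnd ℂ) (f w)) z =
      (starRingEnd ℂ) (vecApp n (conjVec X.2, conjVec X.1) f z) := by
  have h (u : Pt n) : fderiv ℝ (fun w => (starRingEnd ℂ) (f w)) z u =
      (starRingEnd ℂ) (fderiv ℝ f z u) := by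
    have := Complex.conjCLE.comp_fderiv (f := f) (x := z)
    exact congrArg (fun L : Pt n →L[ℝ] ℂ => L u) this
  have h3 : imDir (conjVec X.2, conjVec X.1) = - imDir X := by
    ext j; simp [imDir, conjVec]; ring
  have h4 : reDir (conjVec X.2, conjVec X.1) = reDir X := by
    ext j; simp [reDir, conjVec]; ring
  simp only [vecApp_eq_fderiv, h, h3, h4]
  simp

lemma contDiffAt_vecApp {n m k : ℕ} (X : (Fin n → ℂ) × (Fin n → ℂ)) {f : Pt n → ℂ} {z : Pt n}
    (hf : ContDiffAt ℝ k f z) (hmk : m + 1 ≤ k) :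
    ContDiffAt ℝ m (fun w => vecApp n X f w) z := by
  have h : ContDiffAt ℝ m (fderiv ℝ f) z := hf.fderiv_right (by exact_mod_cast hmk)
  simp only [vecApp_eq_fderiv]
  exact (h.clm_apply contDiffAt_const).add
    (contDiffAt_const.mul (h.clm_apply contDiffAt_const))

lemma contDiffAt_dZ {n m k : ℕ} {f : Pt n → ℂ} {z : Pt n} (j : Fin n)
    (hf : ContDiffAt ℝ k f z) (hmk : m + 1 ≤ k) : ContDiffAt ℝ m (fun w => dZ n f j w) z := by
  simpa only [dZ_eq_vecApp] using contDiffAt_vecApp _ hf hmk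

lemma contDiffAt_dZb {n m k : ℕ} {f : Pt n → ℂ} {z : Pt n} (j : Fin n)
    (hf : ContDiffAt ℝ k f z) (hmk : m + 1 ≤ k) : ContDiffAt ℝ m (fun w => dZb n f j w) z := by
  simpa only [dZb_eq_vecApp] using contDiffAt_vecApp _ hf hmk

lemma vecApp_comm {n k : ℕ} (X Y : (Fin n → ℂ) × (Fin n → ℂ)) {f : Pt n → ℂ} {z : Pt n}
    (hf : ContDiffAt ℝ k f z) (hk : 2 ≤ k) :
    vecApp n X (fun w => vecApp n Y f w) z = vecApp n Y (fun w => vecApp n X f w) z := by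
  have hf2 : ContDiffAt ℝ 2 f z := hf.of_le (by exact_mod_cast hk)
  have hd : DifferentiableAt ℝ (fderiv ℝ f) z :=
    (hf2.fderiv_right (m := 1) (by norm_num)).differentiableAt one_ne_zero
  have key (Z : (Fin n → ℂ) × (Fin n → ℂ)) (u : Pt n) :
      fderiv ℝ (fun w => fderiv ℝ f w (reDir Z) + I * fderiv ℝ f w (imDir Z)) z u =
        fderiv ℝ (fderiv ℝ f) z u (reDir Z) + I * fderiv ℝ (fderiv ℝ f) z u (imDir Z) := by
    have h (v : Pt n) : HasFDerivAt (fun w => fderiv ℝ f w v) ((fderiv ℝ (fderiv ℝ f) z).flip v) z :=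
      (ContinuousLinearMap.apply ℝ ℂ v).hasFDerivAt.comp z hd.hasFDerivAt
    rw [((h _).fun_add ((h _).const_mul I)).fderiv]
    simp
  have hs : IsSymmSndFDerivAt ℝ f z := hf2.isSymmSndFDerivAt (by simp)
  simp only [vecApp_eq_fderiv X, vecApp_eq_fderiv Y, key]
  rw [hs.eq (reDir X), hs.eq (reDir X), hs.eq (imDir X), hs.eq (imDir X)]
  ring

lemma dZ_dZ_comm {n k : ℕ} {f : Pt n → ℂ} {z : Pt n} (i j : Fin n)
    (hf : ContDiffAt ℝ k f z) (hk : 2 ≤ k) :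
    dZ n (fun w => dZ n f j w) i z = dZ n (fun w => dZ n f i w) j z := by
  simpa only [dZ_eq_vecApp] using vecApp_comm _ _ hf hk

lemma dZb_dZb_comm {n k : ℕ} {f : Pt n → ℂ} {z : Pt n} (i j : Fin n)
    (hf : ContDiffAt ℝ k f z) (hk : 2 ≤ k) :
    dZb n (fun w => dZb n f j w) i z = dZb n (fun w => dZb n f i w) j z := by
  simpa only [dZb_eq_vecApp] using vecApp_comm _ _ hf hk

lemma dZb_dZ_comm {n k : ℕ} {f : Pt n → ℂ} {z : Pt n} (i j : Fin n)
    (hf : ContDiffAt ℝ k f z) (hk : 2 ≤ k) :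
    dZb n (fun w => dZ n f j w) i z = dZ n (fun w => dZb n f i w) j z := by
  simpa only [dZb_eq_vecApp, dZ_eq_vecApp] using vecApp_comm _ _ hf hk

lemma dZ_conj {n : ℕ} (f : Pt n → ℂ) (j : Fin n) (z : Pt n) :
    dZ n (fun w => (starRingEnd ℂ) (f w)) j z = (starRingEnd ℂ) (dZb n f j z) := by
  rw [dZ_eq_vecApp, vecApp_conj, dZb_eq_vecApp]
  congr 2
  ext i <;> simp [conjVec, Pi.single_apply, apply_ite]

lemma dZb_conj {n : ℕ} (f : Pt n → ℂ) (j : Fin n) (z : Pt n) :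
    dZb n (fun w => (starRingEnd ℂ) (f w)) j z = (starRingEnd ℂ) (dZ n f j z) := by
  rw [dZb_eq_vecApp, vecApp_conj, dZ_eq_vecApp]
  congr 2
  ext i <;> simp [conjVec, Pi.single_apply, apply_ite]

lemma dZb_cR (n : ℕ) (ρ : Pt n → ℝ) (j : Fin n) (z : Pt n) :
    dZb n (cR n ρ) j z = (starRingEnd ℂ) (dZ n (cR n ρ) j z) := by
  have h : (fun w => (starRingEnd ℂ) (cR n ρ w)) = cR n ρ := by
    ext w
    exact conj_ofReal _
  rw [← dZb_conj, h]

/-- The mixed second derivative ∂²ρ/∂z_j∂z̄_k. -/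
noncomputable def leviCoeff (n : ℕ) (ρ : Pt n → ℝ) (j k : Fin n) (z : Pt n) : ℂ :=
  dZ n (fun w => dZb n (cR n ρ) k w) j z

/-- The coefficients of the normalized complex normal field L_n. -/
noncomputable def normalCoeff (n : ℕ) (ρ : Pt n → ℝ) (j : Fin n) (z : Pt n) : ℂ :=
  (LnVF n ρ).a z j

/-- The coefficients of the conjugate of L_n. -/
noncomputable def conjNormalCoeff (n : ℕ) (ρ : Pt n → ℝ) (j : Fin n) (z : Pt n) : ℂ :=
  (starRingEnd ℂ) (normalCoeff n ρ j z)

/-- ρ is of class C³ near z with nonzero differential at z. -/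
def IsRegularAt (n : ℕ) (ρ : Pt n → ℝ) (z : Pt n) : Prop :=
  ContDiffAt ℝ (3 : ℕ) (cR n ρ) z ∧ gradSq n ρ z ≠ 0

section Regular

variable {n : ℕ} {ρ : Pt n → ℝ} {z : Pt n}

lemma gradSq_eq_sum :
    (gradSq n ρ z : ℂ) = ∑ j, dZ n (cR n ρ) j z * dZb n (cR n ρ) j z := by
  simp [gradSq, dZb_cR, Complex.mul_conj]

lemma leviCoeff_eq_dZb (hz : IsRegularAt n ρ z) (j k : Fin n) :
    leviCoeff n ρ j k z = dZb n (fun w => dZ n (cR n ρ) j w) k z :=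
  (dZb_dZ_comm k j hz.1 (by norm_num)).symm

lemma conj_leviCoeff (hz : IsRegularAt n ρ z) (j k : Fin n) :
    (starRingEnd ℂ) (leviCoeff n ρ j k z) = leviCoeff n ρ k j z := by
  rw [leviCoeff, ← dZb_conj, leviCoeff_eq_dZb hz]
  simp [dZb_cR]

lemma IsRegularAt.eventually (hz : IsRegularAt n ρ z) :
    ∀ᶠ w in nhds z, IsRegularAt n ρ w := by
  refine (hz.1.eventually (by simp)).and ?_
  have h : ContinuousAt (fun w => ∑ j, dZ n (cR n ρ) j w * dZb n (cR n ρ) j w) z := by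
    refine ContDiffAt.continuousAt (𝕜 := ℝ) (n := (2 : ℕ)) (ContDiffAt.sum fun j _ => ?_)
    exact (contDiffAt_dZ j hz.1 (by norm_num)).mul (contDiffAt_dZb j hz.1 (by norm_num))
  have hne := h.eventually_ne (y := 0) (by rw [← gradSq_eq_sum]; exact_mod_cast hz.2)
  filter_upwards [hne] with w hw h0
  exact hw (by rw [← gradSq_eq_sum, h0]; simp)

lemma contDiffAt_normalCoeff (hz : IsRegularAt n ρ z) (j : Fin n) :
    ContDiffAt ℝ (2 : ℕ) (normalCoeff n ρ j) z := by
  have h : normalCoeff n ρ j = fun w => dZb n (cR n ρ) j w *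
      (∑ j, dZ n (cR n ρ) j w * dZb n (cR n ρ) j w)⁻¹ := by
    ext w
    rw [← gradSq_eq_sum, ← div_eq_mul_inv]
    rfl
  rw [h]
  refine (contDiffAt_dZb j hz.1 (by norm_num)).mul (ContDiffAt.inv ?_ ?_)
  · exact ContDiffAt.sum fun j _ =>
      (contDiffAt_dZ j hz.1 (by norm_num)).mul (contDiffAt_dZb j hz.1 (by norm_num))
  · rw [← gradSq_eq_sum]
    exact_mod_cast hz.2

lemma ContDiffAt.conj_comp {m : ℕ} {f : Pt n → ℂ} (hf : ContDiffAt ℝ m f z) :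
    ContDiffAt ℝ m (fun w => (starRingEnd ℂ) (f w)) z :=
  Complex.conjCLE.contDiff.contDiffAt.comp z hf

lemma differentiableAt_normalCoeff (hz : IsRegularAt n ρ z) (j : Fin n) :
    DifferentiableAt ℝ (normalCoeff n ρ j) z :=
  (contDiffAt_normalCoeff hz j).differentiableAt (by norm_num)

lemma differentiableAt_conjNormalCoeff (hz : IsRegularAt n ρ z) (j : Fin n) :
    DifferentiableAt ℝ (conjNormalCoeff n ρ j) z :=
  (contDiffAt_normalCoeff hz j).conj_comp.differentiableAt (by norm_num)

lemma differentiableAt_dZ (hz : IsRegularAt n ρ z) (j : Fin n) :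
    DifferentiableAt ℝ (dZ n (cR n ρ) j) z :=
  (contDiffAt_dZ (m := 1) j hz.1 (by norm_num)).differentiableAt (by norm_num)

lemma differentiableAt_dZb (hz : IsRegularAt n ρ z) (j : Fin n) :
    DifferentiableAt ℝ (dZb n (cR n ρ) j) z :=
  (contDiffAt_dZb (m := 1) j hz.1 (by norm_num)).differentiableAt (by norm_num)

lemma contDiffAt_leviCoeff (hz : IsRegularAt n ρ z) (j k : Fin n) :
    ContDiffAt ℝ (1 : ℕ) (leviCoeff n ρ j k) z :=
  contDiffAt_dZ j (contDiffAt_dZb (m := 2) k hz.1 (by norm_num)) (by norm_num)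

lemma differentiableAt_leviCoeff (hz : IsRegularAt n ρ z) (j k : Fin n) :
    DifferentiableAt ℝ (leviCoeff n ρ j k) z :=
  (contDiffAt_leviCoeff hz j k).differentiableAt (by norm_num)

lemma sum_dZ_mul_normalCoeff (hz : IsRegularAt n ρ z) :
    ∑ r, dZ n (cR n ρ) r z * normalCoeff n ρ r z = 1 := by
  have h : (gradSq n ρ z : ℂ) ≠ 0 := by exact_mod_cast hz.2
  simp only [normalCoeff, LnVF, ← mul_div_assoc]
  rw [← Finset.sum_div, ← gradSq_eq_sum, div_self h]

lemma sum_dZb_mul_conjNormalCoeff (hz : IsRegularAt n ρ z) :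
    ∑ r, dZb n (cR n ρ) r z * conjNormalCoeff n ρ r z = 1 := by
  simpa [conjNormalCoeff, dZb_cR] using congrArg (starRingEnd ℂ) (sum_dZ_mul_normalCoeff hz)

lemma sum_dZ_mul_vecApp_normalCoeff (hz : IsRegularAt n ρ z)
    (X : (Fin n → ℂ) × (Fin n → ℂ)) :
    ∑ r, dZ n (cR n ρ) r z * vecApp n X (normalCoeff n ρ r) z =
      -∑ r, vecApp n X (dZ n (cR n ρ) r) z * normalCoeff n ρ r z := by
  have h := vecApp_sum_mul X (differentiableAt_dZ hz) (differentiableAt_normalCoeff hz)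
  rw [vecApp_congr X (hz.eventually.mono fun w hw => sum_dZ_mul_normalCoeff hw),
    vecApp_const] at h
  linear_combination -h

lemma sum_dZb_mul_vecApp_conjNormalCoeff (hz : IsRegularAt n ρ z)
    (X : (Fin n → ℂ) × (Fin n → ℂ)) :
    ∑ r, dZb n (cR n ρ) r z * vecApp n X (conjNormalCoeff n ρ r) z =
      -∑ r, vecApp n X (dZb n (cR n ρ) r) z * conjNormalCoeff n ρ r z := by
  have h := vecApp_sum_mul X (differentiableAt_dZb hz) (differentiableAt_conjNormalCoeff hz)
  rw [vecApp_congr X (hz.eventually.mono fun w hw => sum_dZb_mul_conjNormalCoeff hw),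
    vecApp_const] at h
  linear_combination -h

lemma vecApp_const_mul (X : (Fin n → ℂ) × (Fin n → ℂ)) (c : ℂ) {f : Pt n → ℂ}
    (hf : DifferentiableAt ℝ f z) : vecApp n X (fun w => c * f w) z = c * vecApp n X f z := by
  rw [vecApp_mul X (differentiableAt_const c) hf, vecApp_const]
  ring

lemma vecApp_neg (X : (Fin n → ℂ) × (Fin n → ℂ)) (f : Pt n → ℂ) :
    vecApp n X (fun w => -f w) z = -vecApp n X f z := by
  simp only [vecApp_eq_fderiv, fderiv_fun_neg]
  simp
  ring

lemma dAngelo_w_eq (hz : IsRegularAt n ρ z) (j : Fin n) :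
    (dAngelo n ρ).w z j = ∑ m, leviCoeff n ρ j m z * conjNormalCoeff n ρ m z := by
  have h1 := sum_dZ_mul_vecApp_normalCoeff hz (Pi.single j 1, 0)
  have h2 := sum_dZb_mul_vecApp_conjNormalCoeff hz (Pi.single j 1, 0)
  simp only [← dZ_eq_vecApp] at h1 h2
  have e1 : (TVF n ρ).app (fun w => (etaF n ρ).w w j) z = (1 / 2 : ℂ) *
      (∑ m, dZ n (dZ n (cR n ρ) m) j z * normalCoeff n ρ m z
        - ∑ m, leviCoeff n ρ j m z * conjNormalCoeff n ρ m z) := by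
    change vecApp n ((TVF n ρ).a z, (TVF n ρ).b z)
      (fun w => (1 / 2 : ℂ) * dZ n (cR n ρ) j w) z = _
    rw [vecApp_const_mul _ _ (differentiableAt_dZ hz j), vecApp, sub_eq_add_neg,
      ← Finset.sum_neg_distrib]
    congr 2
    · refine Finset.sum_congr rfl fun m _ => ?_
      rw [mul_comm, dZ_dZ_comm m j hz.1 (by norm_num)]
      rfl
    · refine Finset.sum_congr rfl fun m _ => ?_
      rw [leviCoeff_eq_dZb hz, mul_comm, ← mul_neg]
      rfl
  have e2 : ∑ m, (etaF n ρ).w z m * dZ n (fun w => (TVF n ρ).a w m) j z =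
      (1 / 2 : ℂ) * ∑ m, dZ n (cR n ρ) m z * dZ n (normalCoeff n ρ m) j z := by
    rw [Finset.mul_sum]
    exact Finset.sum_congr rfl fun m _ => mul_assoc _ _ _
  have e3 : ∑ m, (etaF n ρ).t z m * dZ n (fun w => (TVF n ρ).b w m) j z =
      (1 / 2 : ℂ) * ∑ m, dZb n (cR n ρ) m z * dZ n (conjNormalCoeff n ρ m) j z := by
    rw [Finset.mul_sum]
    refine Finset.sum_congr rfl fun m _ => ?_
    change (-(1 / 2 : ℂ) * dZb n (cR n ρ) m z) * dZ n (fun w => -conjNormalCoeff n ρ m w) j z = _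
    rw [dZ_eq_vecApp, vecApp_neg, ← dZ_eq_vecApp]
    ring
  change -(_ + _ + _) = _
  rw [e1, e2, e3, h1, h2]
  change _ = ∑ m, dZ n (dZb n (cR n ρ) m) j z * conjNormalCoeff n ρ m z
  change -(1 / 2 * (_ - ∑ m, dZ n (dZb n (cR n ρ) m) j z * conjNormalCoeff n ρ m z) + _ + _) = _
  ring

lemma dAngelo_t_eq (hz : IsRegularAt n ρ z) (j : Fin n) :
    (dAngelo n ρ).t z j = ∑ m, leviCoeff n ρ m j z * normalCoeff n ρ m z := by
  have h1 := sum_dZ_mul_vecApp_normalCoeff hz (0, Pi.single j 1)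
  have h2 := sum_dZb_mul_vecApp_conjNormalCoeff hz (0, Pi.single j 1)
  simp only [← dZb_eq_vecApp] at h1 h2
  have e0 (m : Fin n) : dZb n (dZ n (cR n ρ) m) j z = leviCoeff n ρ m j z :=
    (leviCoeff_eq_dZb hz m j).symm
  simp only [e0] at h1
  have e1 : (TVF n ρ).app (fun w => (etaF n ρ).t w j) z = (1 / 2 : ℂ) *
      (∑ m, dZb n (dZb n (cR n ρ) m) j z * conjNormalCoeff n ρ m z
        - ∑ m, leviCoeff n ρ m j z * normalCoeff n ρ m z) := by
    change vecApp n ((TVF n ρ).a z, (TVF n ρ).b z)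
      (fun w => -(1 / 2 : ℂ) * dZb n (cR n ρ) j w) z = _
    rw [vecApp_const_mul _ _ (differentiableAt_dZb hz j), vecApp]
    have f1 : ∑ m, (TVF n ρ).a z m * dZ n (dZb n (cR n ρ) j) m z =
        ∑ m, leviCoeff n ρ m j z * normalCoeff n ρ m z :=
      Finset.sum_congr rfl fun m _ => mul_comm _ _
    have f2 : ∑ m, (TVF n ρ).b z m * dZb n (dZb n (cR n ρ) j) m z =
        -∑ m, dZb n (dZb n (cR n ρ) m) j z * conjNormalCoeff n ρ m z := by
      rw [← Finset.sum_neg_distrib]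
      refine Finset.sum_congr rfl fun m _ => ?_
      have := dZb_dZb_comm m j hz.1 (by norm_num)
      change dZb n (dZb n (cR n ρ) j) m z = dZb n (dZb n (cR n ρ) m) j z at this
      rw [this, mul_comm, ← mul_neg]
      rfl
    change -(1 / 2 : ℂ) * (∑ m, (TVF n ρ).a z m * dZ n (dZb n (cR n ρ) j) m z
      + ∑ m, (TVF n ρ).b z m * dZb n (dZb n (cR n ρ) j) m z) = _
    rw [f1, f2]
    ring
  have e2 : ∑ m, (etaF n ρ).w z m * dZb n (fun w => (TVF n ρ).a w m) j z =
      (1 / 2 : ℂ) * ∑ m, dZ n (cR n ρ) m z * dZb n (normalCoeff n ρ m) j z := by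
    rw [Finset.mul_sum]
    exact Finset.sum_congr rfl fun m _ => mul_assoc _ _ _
  have e3 : ∑ m, (etaF n ρ).t z m * dZb n (fun w => (TVF n ρ).b w m) j z =
      (1 / 2 : ℂ) * ∑ m, dZb n (cR n ρ) m z * dZb n (conjNormalCoeff n ρ m) j z := by
    rw [Finset.mul_sum]
    refine Finset.sum_congr rfl fun m _ => ?_
    change (-(1 / 2 : ℂ) * dZb n (cR n ρ) m z) * dZb n (fun w => -conjNormalCoeff n ρ m w) j z = _
    rw [dZb_eq_vecApp (fun w => -_), vecApp_neg, ← dZb_eq_vecApp]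
    ring
  change -(_ + _ + _) = _
  rw [e1, e2, e3, h1, h2]
  ring

/-- The linear functional of a (1,0)-vector given by its Levi pairing with L_n. -/
noncomputable def leviNormal (n : ℕ) (ρ : Pt n → ℝ) (z : Pt n) (A : Fin n → ℂ) : ℂ :=
  ∑ r, (∑ m, A m * leviCoeff n ρ m r z) * conjNormalCoeff n ρ r z

/-- The holomorphic Hessian of ρ paired with a (1,0)-vector and L_n. -/
noncomputable def hessNormal (n : ℕ) (ρ : Pt n → ℝ) (z : Pt n) (A : Fin n → ℂ) : ℂ :=
  ∑ r, vecApp n (A, 0) (dZ n (cR n ρ) r) z * normalCoeff n ρ r z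

/-- The antiholomorphic Hessian of ρ paired with a (0,1)-vector and the conjugate of L_n. -/
noncomputable def conjHessNormal (n : ℕ) (ρ : Pt n → ℝ) (z : Pt n) (B : Fin n → ℂ) : ℂ :=
  ∑ r, vecApp n (0, conjVec B) (dZb n (cR n ρ) r) z * conjNormalCoeff n ρ r z

lemma sum_mul_leviCoeff (hz : IsRegularAt n ρ z) {A : Fin n → ℂ} (hA : A ∈ nullSp n ρ z)
    (r : Fin n) :
    ∑ m, A m * leviCoeff n ρ m r z = leviNormal n ρ z A * dZb n (cR n ρ) r z := by
  set Y : Fin n → ℂ := fun s => (Pi.single r 1 : Fin n → ℂ) s -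
    dZ n (cR n ρ) r z * normalCoeff n ρ s z with hY
  have hYT : Y ∈ T10 n ρ z := by
    change ∑ j, Y j * dZ n (cR n ρ) j z = 0
    have h := sum_dZ_mul_normalCoeff hz
    have : ∑ j, Y j * dZ n (cR n ρ) j z = dZ n (cR n ρ) r z -
        dZ n (cR n ρ) r z * ∑ j, dZ n (cR n ρ) j z * normalCoeff n ρ j z := by
      simp only [hY, sub_mul, Finset.sum_sub_distrib, Finset.mul_sum]
      congr 1
      · simp [Pi.single_apply]
      · exact Finset.sum_congr rfl fun j _ => by ring
    rw [this, h]
    ring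
  have h := hA.2 Y hYT
  have h' : levi n ρ z A Y = ∑ k, (∑ m, A m * leviCoeff n ρ m k z) * (starRingEnd ℂ) (Y k) := by
    rw [levi, Finset.sum_comm]
    refine Finset.sum_congr rfl fun k _ => ?_
    rw [Finset.sum_mul]
    refine Finset.sum_congr rfl fun m _ => ?_
    rw [leviCoeff]
    ring
  have hYc (k : Fin n) : (starRingEnd ℂ) (Y k) = (Pi.single r 1 : Fin n → ℂ) k -
      dZb n (cR n ρ) r z * conjNormalCoeff n ρ k z := by
    simp [hY, dZb_cR, conjNormalCoeff, Pi.single_apply, apply_ite]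
  rw [h'] at h
  simp only [hYc, mul_sub, Finset.sum_sub_distrib] at h
  have h1 : ∑ k, (∑ m, A m * leviCoeff n ρ m k z) * (Pi.single r 1 : Fin n → ℂ) k =
      ∑ m, A m * leviCoeff n ρ m r z := by
    simp [Pi.single_apply]
  have h2 : ∑ k, (∑ m, A m * leviCoeff n ρ m k z) *
      (dZb n (cR n ρ) r z * conjNormalCoeff n ρ k z) =
      leviNormal n ρ z A * dZb n (cR n ρ) r z := by
    rw [leviNormal, Finset.sum_mul]
    exact Finset.sum_congr rfl fun j _ => by ring
  rw [h1, h2] at h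
  linear_combination h

lemma sum_conjVec_mul_leviCoeff (hz : IsRegularAt n ρ z) {B : Fin n → ℂ}
    (hB : B ∈ nullSp n ρ z) (r : Fin n) :
    ∑ l, conjVec B l * leviCoeff n ρ r l z =
      (starRingEnd ℂ) (leviNormal n ρ z B) * dZ n (cR n ρ) r z := by
  have h := congrArg (starRingEnd ℂ) (sum_mul_leviCoeff hz hB r)
  simpa [conj_leviCoeff hz, dZb_cR, conjVec] using h

lemma vecApp_holomorphic_dZb (A : Fin n → ℂ) (r : Fin n) :
    vecApp n (A, 0) (dZb n (cR n ρ) r) z = ∑ m, A m * leviCoeff n ρ m r z := by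
  simp [vecApp, leviCoeff]

lemma vecApp_antiholomorphic_dZ (hz : IsRegularAt n ρ z) (B : Fin n → ℂ) (r : Fin n) :
    vecApp n (0, B) (dZ n (cR n ρ) r) z = ∑ m, B m * leviCoeff n ρ r m z := by
  simp [vecApp, leviCoeff_eq_dZb hz]

lemma dZ_leviCoeff_comm (hz : IsRegularAt n ρ z) (m l r : Fin n) :
    dZ n (leviCoeff n ρ l r) m z = dZ n (leviCoeff n ρ m r) l z :=
  dZ_dZ_comm m l (contDiffAt_dZb (m := 2) r hz.1 (by norm_num)) le_rfl

lemma dZb_leviCoeff_comm (hz : IsRegularAt n ρ z) (m l r : Fin n) :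
    dZb n (leviCoeff n ρ r l) m z = dZb n (leviCoeff n ρ r m) l z := by
  have h (i j : Fin n) : dZb n (leviCoeff n ρ r i) j z =
      dZb n (fun w => dZb n (fun w => dZ n (cR n ρ) r w) i w) j z := by
    simp only [dZb_eq_vecApp _ j]
    exact vecApp_congr _ (hz.eventually.mono fun w hw => leviCoeff_eq_dZb hw r i)
  rw [h, h]
  exact dZb_dZb_comm m l (contDiffAt_dZ (m := 2) r hz.1 (by norm_num)) le_rfl

/-- The vector T = L_n − conj(L_n) at z. -/
noncomputable def transVec (n : ℕ) (ρ : Pt n → ℝ) (z : Pt n) : (Fin n → ℂ) × (Fin n → ℂ) :=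
  (fun r => normalCoeff n ρ r z, fun r => -conjNormalCoeff n ρ r z)

lemma vecApp_transVec (f : Pt n → ℂ) :
    vecApp n (transVec n ρ z) f z = ∑ r, dZ n f r z * normalCoeff n ρ r z -
      ∑ r, dZb n f r z * conjNormalCoeff n ρ r z := by
  simp [vecApp, transVec, sub_eq_add_neg, mul_comm]

lemma vecApp_transVec_self (hz : IsRegularAt n ρ z) :
    vecApp n (transVec n ρ z) (cR n ρ) z = 0 := by
  rw [vecApp_transVec, sum_dZ_mul_normalCoeff hz, sum_dZb_mul_conjNormalCoeff hz, sub_self]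

/-- The Lie derivative along T of the Levi form at z, evaluated on (A, conj B), for
A and B in the null space. -/
noncomputable def lieLevi (n : ℕ) (ρ : Pt n → ℝ) (z : Pt n) (A B : Fin n → ℂ) : ℂ :=
  ∑ m, ∑ l, vecApp n (transVec n ρ z) (leviCoeff n ρ m l) z * (A m * conjVec B l) -
    (starRingEnd ℂ) (leviNormal n ρ z B) * hessNormal n ρ z A +
    leviNormal n ρ z A * conjHessNormal n ρ z B

/-- Extension of A to a field of (1,0)-vectors tangential to the level sets of ρ. -/
noncomputable def tangentField (n : ℕ) (ρ : Pt n → ℝ) (A : Fin n → ℂ) (m : Fin n)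
    (z : Pt n) : ℂ :=
  A m - (∑ s, A s * dZ n (cR n ρ) s z) * normalCoeff n ρ m z

lemma tangentField_self {A : Fin n → ℂ} (hA : A ∈ T10 n ρ z) (m : Fin n) :
    tangentField n ρ A m z = A m := by
  change ∑ j, A j * dZ n (cR n ρ) j z = 0 at hA
  simp [tangentField, hA]

lemma tangentField_mem_T10 (hz : IsRegularAt n ρ z) (A : Fin n → ℂ) :
    (fun m => tangentField n ρ A m z) ∈ T10 n ρ z := by
  change ∑ j, tangentField n ρ A j z * dZ n (cR n ρ) j z = 0
  have h : ∑ j, tangentField n ρ A j z * dZ n (cR n ρ) j z =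
      ∑ s, A s * dZ n (cR n ρ) s z - (∑ s, A s * dZ n (cR n ρ) s z) *
        ∑ j, dZ n (cR n ρ) j z * normalCoeff n ρ j z := by
    simp only [tangentField, sub_mul, Finset.sum_sub_distrib]
    congr 1
    rw [Finset.mul_sum]
    exact Finset.sum_congr rfl fun j _ => by ring
  rw [h, sum_dZ_mul_normalCoeff hz]
  ring

lemma contDiffAt_tangentField (hz : IsRegularAt n ρ z) (A : Fin n → ℂ) (m : Fin n) :
    ContDiffAt ℝ (1 : ℕ) (tangentField n ρ A m) z := by
  refine contDiffAt_const.sub (ContDiffAt.mul (ContDiffAt.sum fun s _ => ?_) ?_)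
  · exact contDiffAt_const.mul (contDiffAt_dZ s hz.1 (by norm_num))
  · exact (contDiffAt_normalCoeff hz m).of_le (by norm_num)

lemma vecApp_ofReal_eq_zero_of_isLocalMinOn {f : Pt n → ℝ} (hf : ContDiffAt ℝ 1 f z)
    (hρ : ContDiffAt ℝ 1 ρ z) (hd : fderiv ℝ ρ z ≠ 0)
    (hmin : IsLocalMinOn f {w | ρ w = ρ z} z) {X : (Fin n → ℂ) × (Fin n → ℂ)}
    (hX : vecApp n X (cR n ρ) z = 0) : vecApp n X (cR n f) z = 0 := by
  obtain ⟨a, b, hab, h⟩ := IsLocalExtrOn.exists_multipliers_of_hasStrictFDerivAt_1d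
    (Or.inl hmin) (hρ.hasStrictFDerivAt one_ne_zero) (hf.hasStrictFDerivAt one_ne_zero)
  have hb : b ≠ 0 := by
    rintro rfl
    have ha : a ≠ 0 := by
      rintro rfl
      exact hab rfl
    rw [zero_smul, add_zero] at h
    exact hd ((smul_eq_zero.1 h).resolve_left ha)
  have hre {g : Pt n → ℝ} (hg : ContDiffAt ℝ 1 g z) (u : Pt n) :
      fderiv ℝ (cR n g) z u = (fderiv ℝ g z u : ℂ) := by
    have := (Complex.ofRealCLM.hasFDerivAt.comp z
      (hg.differentiableAt one_ne_zero).hasFDerivAt).fderiv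
    exact congrArg (fun L : Pt n →L[ℝ] ℂ => L u) this
  rw [vecApp_eq_fderiv, hre hρ, hre hρ] at hX
  rw [vecApp_eq_fderiv, hre hf, hre hf]
  have hu (u : Pt n) : (a : ℂ) * (fderiv ℝ ρ z u : ℂ) + b * (fderiv ℝ f z u : ℂ) = 0 := by
    have := congrArg (fun L : Pt n →L[ℝ] ℝ => L u) h
    simp only [add_apply, smul_apply, smul_eq_mul, zero_apply] at this
    exact_mod_cast this
  have hbc : (b : ℂ) ≠ 0 := by exact_mod_cast hb
  refine (mul_eq_zero.1 ?_).resolve_left hbc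
  linear_combination hu (reDir X) + I * hu (imDir X) - a * hX

lemma levi_eq_sum (X : Fin n → ℂ) : levi n ρ z X X =
    ∑ m, X m * ∑ l, leviCoeff n ρ m l z * (starRingEnd ℂ) (X l) := by
  simp only [levi, Finset.mul_sum]
  refine Finset.sum_congr rfl fun m _ => Finset.sum_congr rfl fun l _ => ?_
  rw [leviCoeff]
  ring

lemma levi_self_conj (hz : IsRegularAt n ρ z) (X : Fin n → ℂ) :
    (starRingEnd ℂ) (levi n ρ z X X) = levi n ρ z X X := by
  have h : levi n ρ z X X =
      ∑ m, ∑ l, leviCoeff n ρ m l z * X m * (starRingEnd ℂ) (X l) := rfl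
  rw [h, map_sum, Finset.sum_comm]
  simp only [map_sum, map_mul, conj_leviCoeff hz, conj_conj]
  exact Finset.sum_congr rfl fun m _ => Finset.sum_congr rfl fun l _ => by ring

lemma lieLevi_self (hz : IsRegularAt n ρ z) (hρ : ContDiffAt ℝ 1 ρ z)
    (hd : fderiv ℝ ρ z ≠ 0)
    (hlev : ∀ᶠ w in nhds z, ρ w = ρ z → ∀ X ∈ T10 n ρ w, 0 ≤ (levi n ρ w X X).re)
    {A : Fin n → ℂ} (hA : A ∈ nullSp n ρ z) : lieLevi n ρ z A A = 0 := by
  set F : Pt n → ℂ := fun w => ∑ m, tangentField n ρ A m w *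
    ∑ l, leviCoeff n ρ m l w * (starRingEnd ℂ) (tangentField n ρ A l w) with hF
  have hFl (w : Pt n) : F w = levi n ρ w (fun m => tangentField n ρ A m w)
    (fun m => tangentField n ρ A m w) := (levi_eq_sum _).symm
  have hXc (m : Fin n) := contDiffAt_tangentField hz A m
  have hGc (m : Fin n) : ContDiffAt ℝ (1 : ℕ) (fun w => ∑ l, leviCoeff n ρ m l w *
      (starRingEnd ℂ) (tangentField n ρ A l w)) z :=
    ContDiffAt.sum fun l _ => (contDiffAt_leviCoeff hz m l).mul (hXc l).conj_comp
  have hFc : ContDiffAt ℝ (1 : ℕ) F z := ContDiffAt.sum fun m _ => (hXc m).mul (hGc m)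
  have hre : F =ᶠ[nhds z] cR n (fun w => (F w).re) := by
    filter_upwards [hz.eventually] with w hw
    have := levi_self_conj hw (fun m => tangentField n ρ A m w)
    rw [← hFl] at this
    exact (conj_eq_iff_re.1 this).symm
  have hAz : (fun m => tangentField n ρ A m z) = A := funext (tangentField_self hA.1)
  have hF0 : F z = 0 := by rw [hFl, hAz]; exact hA.2 A hA.1
  have hmin : IsLocalMinOn (fun w => (F w).re) {w | ρ w = ρ z} z := by
    filter_upwards [mem_nhdsWithin_of_mem_nhds hlev, self_mem_nhdsWithin,
      mem_nhdsWithin_of_mem_nhds hz.eventually] with w hw hwz hwr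
    rw [hF0, hFl]
    exact hw hwz _ (tangentField_mem_T10 hwr A)
  have hmain : vecApp n (transVec n ρ z) F z = 0 := by
    rw [vecApp_congr _ hre]
    refine vecApp_ofReal_eq_zero_of_isLocalMinOn ?_ hρ hd hmin (vecApp_transVec_self hz)
    exact Complex.reCLM.contDiff.contDiffAt.comp z hFc
  have hXd (m : Fin n) : DifferentiableAt ℝ (tangentField n ρ A m) z :=
    (hXc m).differentiableAt (by norm_num)
  have hXbd (m : Fin n) :
      DifferentiableAt ℝ (fun w => (starRingEnd ℂ) (tangentField n ρ A m w)) z :=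
    (hXc m).conj_comp.differentiableAt (by norm_num)
  set τ := transVec n ρ z with hτ
  set μ := (starRingEnd ℂ) (leviNormal n ρ z A) with hμ
  have hA' (m : Fin n) : tangentField n ρ A m z = A m := tangentField_self hA.1 m
  have hAc (m : Fin n) : (starRingEnd ℂ) (tangentField n ρ A m z) = conjVec A m := by
    rw [hA']; rfl
  have hexp : vecApp n τ F z =
      ∑ m, vecApp n τ (tangentField n ρ A m) z * (μ * dZ n (cR n ρ) m z) +
      (∑ m, ∑ l, vecApp n τ (leviCoeff n ρ m l) z * (A m * conjVec A l) +
      ∑ l, leviNormal n ρ z A * dZb n (cR n ρ) l z *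
        vecApp n τ (fun w => (starRingEnd ℂ) (tangentField n ρ A l w)) z) := by
    rw [hF, vecApp_sum_mul τ hXd fun m => (hGc m).differentiableAt (by norm_num)]
    congr 1
    · refine Finset.sum_congr rfl fun m _ => ?_
      rw [← sum_conjVec_mul_leviCoeff hz hA m]
      simp only [hAc, mul_comm]
    · have (m : Fin n) := vecApp_sum_mul τ (fun l => differentiableAt_leviCoeff hz m l) hXbd
      simp only [this, hA', mul_add, Finset.sum_add_distrib, Finset.mul_sum]
      congr 1
      · refine Finset.sum_congr rfl fun m _ => Finset.sum_congr rfl fun l _ => ?_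
        rw [conjVec]
        ring
      · rw [Finset.sum_comm]
        refine Finset.sum_congr rfl fun l _ => ?_
        rw [← sum_mul_leviCoeff hz hA l, Finset.sum_mul]
        exact Finset.sum_congr rfl fun m _ => by ring
  have hS1 : ∑ m, vecApp n τ (tangentField n ρ A m) z * dZ n (cR n ρ) m z =
      -∑ m, A m * vecApp n τ (dZ n (cR n ρ) m) z := by
    have h := vecApp_sum_mul τ hXd (differentiableAt_dZ hz)
    rw [vecApp_congr τ (hz.eventually.mono fun w hw => tangentField_mem_T10 hw A),
      vecApp_const] at h
    simp only [hA'] at h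
    linear_combination -h
  have hS2 : ∑ l, dZb n (cR n ρ) l z *
        vecApp n τ (fun w => (starRingEnd ℂ) (tangentField n ρ A l w)) z =
      -∑ l, vecApp n τ (dZb n (cR n ρ) l) z * conjVec A l := by
    have h := vecApp_sum_mul τ (differentiableAt_dZb hz) hXbd
    have h0 : (fun w => ∑ r, dZb n (cR n ρ) r w * (starRingEnd ℂ) (tangentField n ρ A r w))
        =ᶠ[nhds z] fun _ => (0 : ℂ) := by
      filter_upwards [hz.eventually] with w hw
      have h1 : ∑ j, tangentField n ρ A j w * dZ n (cR n ρ) j w = 0 := tangentField_mem_T10 hw A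
      simpa [dZb_cR, mul_comm] using congrArg (starRingEnd ℂ) h1
    rw [vecApp_congr τ h0, vecApp_const] at h
    simp only [hAc] at h
    linear_combination -h
  have hS3 : ∑ m, A m * vecApp n τ (dZ n (cR n ρ) m) z =
      hessNormal n ρ z A - leviNormal n ρ z A := by
    simp only [hτ, vecApp_transVec, mul_sub, Finset.sum_sub_distrib, hessNormal, leviNormal]
    congr 1
    · simp only [Finset.mul_sum]
      rw [Finset.sum_comm]
      refine Finset.sum_congr rfl fun r _ => ?_
      simp only [vecApp, Pi.zero_apply, zero_mul, Finset.sum_const_zero, add_zero,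
        Finset.sum_mul, ← mul_assoc]
      refine Finset.sum_congr rfl fun m _ => ?_
      have := dZ_dZ_comm m r hz.1 (by norm_num)
      change dZ n (dZ n (cR n ρ) r) m z = dZ n (dZ n (cR n ρ) m) r z at this
      rw [this]
    · simp only [Finset.mul_sum, Finset.sum_mul, leviCoeff_eq_dZb hz]
      rw [Finset.sum_comm]
      exact Finset.sum_congr rfl fun r _ => Finset.sum_congr rfl fun m _ => (mul_assoc _ _ _).symm
  have hS4 : ∑ l, vecApp n τ (dZb n (cR n ρ) l) z * conjVec A l =
      μ - conjHessNormal n ρ z A := by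
    simp only [hτ, vecApp_transVec, sub_mul, Finset.sum_sub_distrib, conjHessNormal]
    congr 1
    · have h1 : μ = ∑ r, (∑ l, conjVec A l * leviCoeff n ρ r l z) * normalCoeff n ρ r z := by
        simp [hμ, leviNormal, conj_leviCoeff hz, conjNormalCoeff, conjVec]
      rw [h1]
      simp only [Finset.sum_mul]
      rw [Finset.sum_comm]
      refine Finset.sum_congr rfl fun r _ => Finset.sum_congr rfl fun l _ => ?_
      change dZ n (dZb n (cR n ρ) l) r z * _ * _ = _ * dZ n (dZb n (cR n ρ) l) r z * _
      ring
    · simp only [Finset.sum_mul]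
      rw [Finset.sum_comm]
      refine Finset.sum_congr rfl fun r _ => ?_
      simp only [vecApp, Pi.zero_apply, zero_mul, Finset.sum_const_zero, zero_add,
        Finset.sum_mul]
      refine Finset.sum_congr rfl fun m _ => ?_
      have := dZb_dZb_comm m r hz.1 (by norm_num)
      change dZb n (dZb n (cR n ρ) r) m z = dZb n (dZb n (cR n ρ) m) r z at this
      rw [this]
      ring
  have hT1 : ∑ m, vecApp n τ (tangentField n ρ A m) z * (μ * dZ n (cR n ρ) m z) =
      μ * ∑ m, vecApp n τ (tangentField n ρ A m) z * dZ n (cR n ρ) m z := by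
    rw [Finset.mul_sum]
    exact Finset.sum_congr rfl fun m _ => by ring
  have hT2 : ∑ l, leviNormal n ρ z A * dZb n (cR n ρ) l z *
        vecApp n τ (fun w => (starRingEnd ℂ) (tangentField n ρ A l w)) z =
      leviNormal n ρ z A * ∑ l, dZb n (cR n ρ) l z *
        vecApp n τ (fun w => (starRingEnd ℂ) (tangentField n ρ A l w)) z := by
    rw [Finset.mul_sum]
    exact Finset.sum_congr rfl fun m _ => by ring
  rw [hmain, hT1, hT2, hS1, hS2, hS3, hS4] at hexp
  rw [lieLevi]
  linear_combination -hexp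

lemma vecApp_add_left (X Y : (Fin n → ℂ) × (Fin n → ℂ)) (f : Pt n → ℂ) :
    vecApp n (X + Y) f z = vecApp n X f z + vecApp n Y f z := by
  simp only [vecApp, Prod.fst_add, Prod.snd_add, Pi.add_apply, add_mul, Finset.sum_add_distrib]
  ring

lemma vecApp_smul_left (c : ℂ) (X : (Fin n → ℂ) × (Fin n → ℂ)) (f : Pt n → ℂ) :
    vecApp n (c • X) f z = c * vecApp n X f z := by
  simp [vecApp, mul_add, Finset.mul_sum, mul_assoc]

lemma conjVec_add (A B : Fin n → ℂ) : conjVec (A + B) = conjVec A + conjVec B := by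
  ext j; simp [conjVec]

lemma conjVec_smul (c : ℂ) (A : Fin n → ℂ) :
    conjVec (c • A) = (starRingEnd ℂ) c • conjVec A := by
  ext j; simp [conjVec]

lemma leviNormal_add (A B : Fin n → ℂ) :
    leviNormal n ρ z (A + B) = leviNormal n ρ z A + leviNormal n ρ z B := by
  simp [leviNormal, add_mul, Finset.sum_add_distrib]

lemma leviNormal_smul (c : ℂ) (A : Fin n → ℂ) :
    leviNormal n ρ z (c • A) = c * leviNormal n ρ z A := by
  simp [leviNormal, Finset.mul_sum, Finset.sum_mul, mul_assoc]

lemma hessNormal_add (A B : Fin n → ℂ) :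
    hessNormal n ρ z (A + B) = hessNormal n ρ z A + hessNormal n ρ z B := by
  have h : ((A + B, 0) : (Fin n → ℂ) × (Fin n → ℂ)) = (A, 0) + (B, 0) := by simp
  simp only [hessNormal, h, vecApp_add_left, add_mul, Finset.sum_add_distrib]

lemma hessNormal_smul (c : ℂ) (A : Fin n → ℂ) :
    hessNormal n ρ z (c • A) = c * hessNormal n ρ z A := by
  have h : ((c • A, 0) : (Fin n → ℂ) × (Fin n → ℂ)) = c • (A, 0) := by simp
  simp only [hessNormal, h, vecApp_smul_left, Finset.mul_sum, mul_assoc]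

lemma conjHessNormal_add (A B : Fin n → ℂ) :
    conjHessNormal n ρ z (A + B) = conjHessNormal n ρ z A + conjHessNormal n ρ z B := by
  have h : ((0, conjVec (A + B)) : (Fin n → ℂ) × (Fin n → ℂ)) =
      (0, conjVec A) + (0, conjVec B) := by simp [conjVec_add]
  simp only [conjHessNormal, h, vecApp_add_left, add_mul, Finset.sum_add_distrib]

lemma conjHessNormal_smul (c : ℂ) (A : Fin n → ℂ) :
    conjHessNormal n ρ z (c • A) = (starRingEnd ℂ) c * conjHessNormal n ρ z A := by
  have h : ((0, conjVec (c • A)) : (Fin n → ℂ) × (Fin n → ℂ)) =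
      (starRingEnd ℂ) c • (0, conjVec A) := by simp [conjVec_smul]
  simp only [conjHessNormal, h, vecApp_smul_left, Finset.mul_sum, mul_assoc]

lemma lieLevi_add_left (A A' B : Fin n → ℂ) :
    lieLevi n ρ z (A + A') B = lieLevi n ρ z A B + lieLevi n ρ z A' B := by
  simp only [lieLevi, leviNormal_add, hessNormal_add, Pi.add_apply, add_mul, mul_add,
    Finset.sum_add_distrib]
  ring

lemma lieLevi_add_right (A B B' : Fin n → ℂ) :
    lieLevi n ρ z A (B + B') = lieLevi n ρ z A B + lieLevi n ρ z A B' := by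
  simp only [lieLevi, leviNormal_add, conjHessNormal_add, conjVec_add, Pi.add_apply, map_add,
    add_mul, mul_add, Finset.sum_add_distrib]
  ring

lemma lieLevi_smul_left (c : ℂ) (A B : Fin n → ℂ) :
    lieLevi n ρ z (c • A) B = c * lieLevi n ρ z A B := by
  simp only [lieLevi, leviNormal_smul, hessNormal_smul, Pi.smul_apply, smul_eq_mul, mul_add,
    mul_sub, Finset.mul_sum]
  congr 1
  · congr 1
    · exact Finset.sum_congr rfl fun m _ => Finset.sum_congr rfl fun l _ => by ring
    · ring
  · ring

lemma lieLevi_smul_right (c : ℂ) (A B : Fin n → ℂ) :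
    lieLevi n ρ z A (c • B) = (starRingEnd ℂ) c * lieLevi n ρ z A B := by
  simp only [lieLevi, leviNormal_smul, conjHessNormal_smul, conjVec_smul, map_mul, Pi.smul_apply,
    smul_eq_mul, mul_add, mul_sub, Finset.mul_sum]
  congr 1
  · congr 1
    · exact Finset.sum_congr rfl fun m _ => Finset.sum_congr rfl fun l _ => by ring
    · ring
  · ring

lemma add_smul_mem_nullSp {A B : Fin n → ℂ} (hA : A ∈ nullSp n ρ z) (hB : B ∈ nullSp n ρ z)
    (c : ℂ) : A + c • B ∈ nullSp n ρ z := by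
  refine ⟨?_, fun Y hY => ?_⟩
  · have hA1 : ∑ j, A j * dZ n (cR n ρ) j z = 0 := hA.1
    have hB1 : ∑ j, B j * dZ n (cR n ρ) j z = 0 := hB.1
    change ∑ j, (A + c • B) j * dZ n (cR n ρ) j z = 0
    simp only [Pi.add_apply, Pi.smul_apply, smul_eq_mul, add_mul, Finset.sum_add_distrib,
      mul_assoc, ← Finset.mul_sum, hA1, hB1]
    ring
  · have hA2 := hA.2 Y hY
    have hB2 := hB.2 Y hY
    have h : levi n ρ z (A + c • B) Y = levi n ρ z A Y + c * levi n ρ z B Y := by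
      simp only [levi, Finset.mul_sum, ← Finset.sum_add_distrib]
      refine Finset.sum_congr rfl fun m _ => Finset.sum_congr rfl fun l _ => ?_
      simp only [Pi.add_apply, Pi.smul_apply, smul_eq_mul]
      ring
    rw [h, hA2, hB2]
    ring

lemma lieLevi_eq_zero (hz : IsRegularAt n ρ z) (hρ : ContDiffAt ℝ 1 ρ z)
    (hd : fderiv ℝ ρ z ≠ 0)
    (hlev : ∀ᶠ w in nhds z, ρ w = ρ z → ∀ X ∈ T10 n ρ w, 0 ≤ (levi n ρ w X X).re)
    {A B : Fin n → ℂ} (hA : A ∈ nullSp n ρ z) (hB : B ∈ nullSp n ρ z) :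
    lieLevi n ρ z A B = 0 := by
  have key (c : ℂ) := lieLevi_self hz hρ hd hlev (add_smul_mem_nullSp hA hB c)
  simp only [lieLevi_add_left, lieLevi_add_right, lieLevi_smul_left, lieLevi_smul_right,
    lieLevi_self hz hρ hd hlev hA, lieLevi_self hz hρ hd hlev hB] at key
  have h1 := key 1
  have h2 := key I
  simp only [map_one, conj_I] at h1 h2
  linear_combination (1 / 2 : ℂ) * h1 + (I / 2) * h2 +
    (1 / 2 : ℂ) * (lieLevi n ρ z A B - lieLevi n ρ z B A) * I_sq

lemma dZ_sum_mul {f g : Fin n → Pt n → ℂ} (hf : ∀ r, DifferentiableAt ℝ (f r) z)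
    (hg : ∀ r, DifferentiableAt ℝ (g r) z) (m : Fin n) :
    dZ n (fun w => ∑ r, f r w * g r w) m z =
      ∑ r, dZ n (f r) m z * g r z + ∑ r, f r z * dZ n (g r) m z := by
  simpa only [dZ_eq_vecApp] using vecApp_sum_mul _ hf hg

lemma dZb_sum_mul {f g : Fin n → Pt n → ℂ} (hf : ∀ r, DifferentiableAt ℝ (f r) z)
    (hg : ∀ r, DifferentiableAt ℝ (g r) z) (m : Fin n) :
    dZb n (fun w => ∑ r, f r w * g r w) m z =
      ∑ r, dZb n (f r) m z * g r z + ∑ r, f r z * dZb n (g r) m z := by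
  simpa only [dZb_eq_vecApp] using vecApp_sum_mul _ hf hg

lemma dZ_congr {f g : Pt n → ℂ} (h : f =ᶠ[nhds z] g) (m : Fin n) :
    dZ n f m z = dZ n g m z := by
  simpa only [dZ_eq_vecApp] using vecApp_congr _ h

lemma dZb_congr {f g : Pt n → ℂ} (h : f =ᶠ[nhds z] g) (m : Fin n) :
    dZb n f m z = dZb n g m z := by
  simpa only [dZb_eq_vecApp] using vecApp_congr _ h

lemma sum_contract {ι : Type*} [Fintype ι] (D : ι → ι → ι → ℂ) (h d : ι → ι → ℂ)
    (s A A' : ι → ℂ) :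
    ∑ m, ∑ l, (∑ r, D m l r * s r + ∑ r, h l r * d m r) * (A m * A' l) =
      ∑ m, ∑ l, (∑ r, D m l r * s r) * (A m * A' l) +
        ∑ r, (∑ l, A' l * h l r) * ∑ m, A m * d m r := by
  simp only [add_mul, Finset.sum_add_distrib]
  congr 1
  simp only [Finset.sum_mul, Finset.mul_sum]
  rw [Finset.sum_congr rfl fun m _ => Finset.sum_comm, Finset.sum_comm]
  refine Finset.sum_congr rfl fun r _ => ?_
  exact Finset.sum_congr rfl fun l _ => Finset.sum_congr rfl fun m _ => by ring

lemma vecApp_holomorphic (A : Fin n → ℂ) (f : Pt n → ℂ) :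
    ∑ m, A m * dZ n f m z = vecApp n (A, 0) f z := by
  simp [vecApp]

lemma vecApp_antiholomorphic (B : Fin n → ℂ) (f : Pt n → ℂ) :
    ∑ m, B m * dZb n f m z = vecApp n (0, B) f z := by
  simp [vecApp]

lemma sum_dZ_dAngelo_w (hz : IsRegularAt n ρ z) (A : Fin n → ℂ) {A' : Fin n → ℂ}
    (hA' : A' ∈ nullSp n ρ z) :
    ∑ m, ∑ l, dZ n (fun w => (dAngelo n ρ).w w l) m z * (A m * A' l) =
      ∑ m, ∑ l, (∑ r, dZ n (leviCoeff n ρ l r) m z * conjNormalCoeff n ρ r z) * (A m * A' l) -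
        leviNormal n ρ z A * leviNormal n ρ z A' := by
  simp only [dZ_congr (hz.eventually.mono fun w hw => dAngelo_w_eq hw _),
    dZ_sum_mul (fun r => differentiableAt_leviCoeff hz _ r) (differentiableAt_conjNormalCoeff hz)]
  rw [sum_contract]
  simp only [sum_mul_leviCoeff hz hA', vecApp_holomorphic, mul_assoc]
  rw [← Finset.mul_sum, sum_dZb_mul_vecApp_conjNormalCoeff hz]
  simp only [vecApp_holomorphic_dZb]
  change _ + _ * -leviNormal n ρ z A = _
  ring

lemma sum_dZb_dAngelo_t (hz : IsRegularAt n ρ z) {B B' : Fin n → ℂ} (hB : B ∈ nullSp n ρ z)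
    (hB' : B' ∈ nullSp n ρ z) :
    ∑ m, ∑ l, dZb n (fun w => (dAngelo n ρ).t w l) m z * (conjVec B m * conjVec B' l) =
      ∑ m, ∑ l, (∑ r, dZb n (leviCoeff n ρ r l) m z * normalCoeff n ρ r z) *
        (conjVec B m * conjVec B' l) -
        (starRingEnd ℂ) (leviNormal n ρ z B) * (starRingEnd ℂ) (leviNormal n ρ z B') := by
  simp only [dZb_congr (hz.eventually.mono fun w hw => dAngelo_t_eq hw _),
    dZb_sum_mul (fun r => differentiableAt_leviCoeff hz r _) (differentiableAt_normalCoeff hz)]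
  rw [sum_contract _ (fun l r => leviCoeff n ρ r l z)]
  simp only [sum_conjVec_mul_leviCoeff hz hB', vecApp_antiholomorphic, mul_assoc]
  rw [← Finset.mul_sum, sum_dZ_mul_vecApp_normalCoeff hz]
  simp only [vecApp_antiholomorphic_dZ hz, sum_conjVec_mul_leviCoeff hz hB, mul_assoc]
  rw [← Finset.mul_sum, sum_dZ_mul_normalCoeff hz]
  ring

lemma sum_dZ_dAngelo_t (hz : IsRegularAt n ρ z) (A : Fin n → ℂ) {B : Fin n → ℂ}
    (hB : B ∈ nullSp n ρ z) :
    ∑ m, ∑ l, dZ n (fun w => (dAngelo n ρ).t w l) m z * (A m * conjVec B l) =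
      ∑ m, ∑ l, (∑ r, dZ n (leviCoeff n ρ r l) m z * normalCoeff n ρ r z) *
        (A m * conjVec B l) -
        (starRingEnd ℂ) (leviNormal n ρ z B) * hessNormal n ρ z A := by
  simp only [dZ_congr (hz.eventually.mono fun w hw => dAngelo_t_eq hw _),
    dZ_sum_mul (fun r => differentiableAt_leviCoeff hz r _) (differentiableAt_normalCoeff hz)]
  rw [sum_contract _ (fun l r => leviCoeff n ρ r l z)]
  simp only [sum_conjVec_mul_leviCoeff hz hB, vecApp_holomorphic, mul_assoc]
  rw [← Finset.mul_sum, sum_dZ_mul_vecApp_normalCoeff hz]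
  change _ + _ * -hessNormal n ρ z A = _
  ring

lemma sum_dZb_dAngelo_w (hz : IsRegularAt n ρ z) {A : Fin n → ℂ} (B : Fin n → ℂ)
    (hA : A ∈ nullSp n ρ z) :
    ∑ m, ∑ l, dZb n (fun w => (dAngelo n ρ).w w l) m z * (conjVec B m * A l) =
      ∑ m, ∑ l, (∑ r, dZb n (leviCoeff n ρ l r) m z * conjNormalCoeff n ρ r z) *
        (conjVec B m * A l) -
        leviNormal n ρ z A * conjHessNormal n ρ z B := by
  simp only [dZb_congr (hz.eventually.mono fun w hw => dAngelo_w_eq hw _),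
    dZb_sum_mul (fun r => differentiableAt_leviCoeff hz _ r) (differentiableAt_conjNormalCoeff hz)]
  rw [sum_contract]
  simp only [sum_mul_leviCoeff hz hA, vecApp_antiholomorphic, mul_assoc]
  rw [← Finset.mul_sum, sum_dZb_mul_vecApp_conjNormalCoeff hz]
  change _ + _ * -conjHessNormal n ρ z B = _
  ring

lemma sum_dZ_dAngelo_w_comm (hz : IsRegularAt n ρ z) {A A' : Fin n → ℂ}
    (hA : A ∈ nullSp n ρ z) (hA' : A' ∈ nullSp n ρ z) :
    ∑ m, ∑ l, dZ n (fun w => (dAngelo n ρ).w w l) m z * (A m * A' l) =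
      ∑ m, ∑ l, dZ n (fun w => (dAngelo n ρ).w w l) m z * (A' m * A l) := by
  rw [sum_dZ_dAngelo_w hz A hA', sum_dZ_dAngelo_w hz A' hA, mul_comm (leviNormal n ρ z A)]
  congr 1
  rw [Finset.sum_comm]
  refine Finset.sum_congr rfl fun m _ => Finset.sum_congr rfl fun l _ => ?_
  simp only [dZ_leviCoeff_comm hz l m, mul_comm (A l)]

lemma sum_dZb_dAngelo_t_comm (hz : IsRegularAt n ρ z) {B B' : Fin n → ℂ}
    (hB : B ∈ nullSp n ρ z) (hB' : B' ∈ nullSp n ρ z) :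
    ∑ m, ∑ l, dZb n (fun w => (dAngelo n ρ).t w l) m z * (conjVec B m * conjVec B' l) =
      ∑ m, ∑ l, dZb n (fun w => (dAngelo n ρ).t w l) m z * (conjVec B' m * conjVec B l) := by
  rw [sum_dZb_dAngelo_t hz hB hB', sum_dZb_dAngelo_t hz hB' hB,
    mul_comm ((starRingEnd ℂ) (leviNormal n ρ z B))]
  congr 1
  rw [Finset.sum_comm]
  refine Finset.sum_congr rfl fun m _ => Finset.sum_congr rfl fun l _ => ?_
  simp only [dZb_leviCoeff_comm hz l m, mul_comm (conjVec B l)]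

lemma sum_dZ_dAngelo_t_sub (hz : IsRegularAt n ρ z) {A B : Fin n → ℂ}
    (hA : A ∈ nullSp n ρ z) (hB : B ∈ nullSp n ρ z) :
    ∑ m, ∑ l, dZ n (fun w => (dAngelo n ρ).t w l) m z * (A m * conjVec B l) -
      ∑ m, ∑ l, dZb n (fun w => (dAngelo n ρ).w w l) m z * (conjVec B m * A l) =
      lieLevi n ρ z A B := by
  rw [sum_dZ_dAngelo_t hz A hB, sum_dZb_dAngelo_w hz B hA, lieLevi]
  simp only [vecApp_transVec, sub_mul, Finset.sum_sub_distrib]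
  have h1 : ∑ m, ∑ l, (∑ r, dZ n (leviCoeff n ρ r l) m z * normalCoeff n ρ r z) *
        (A m * conjVec B l) =
      ∑ m, ∑ l, (∑ r, dZ n (leviCoeff n ρ m l) r z * normalCoeff n ρ r z) *
        (A m * conjVec B l) := by
    refine Finset.sum_congr rfl fun m _ => Finset.sum_congr rfl fun l _ => ?_
    simp only [dZ_leviCoeff_comm hz m]
  have h2 : ∑ m, ∑ l, (∑ r, dZb n (leviCoeff n ρ l r) m z * conjNormalCoeff n ρ r z) *
        (conjVec B m * A l) =
      ∑ m, ∑ l, (∑ r, dZb n (leviCoeff n ρ m l) r z * conjNormalCoeff n ρ r z) *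
        (A m * conjVec B l) := by
    rw [Finset.sum_comm]
    refine Finset.sum_congr rfl fun m _ => Finset.sum_congr rfl fun l _ => ?_
    simp only [dZb_leviCoeff_comm hz l, mul_comm (A m)]
  rw [h1, h2]
  ring

end Regular

lemma gradSq_ne_zero {n : ℕ} {ρ : Pt n → ℝ} {z : Pt n} (hρ : DifferentiableAt ℝ ρ z)
    (hd : fderiv ℝ ρ z ≠ 0) : gradSq n ρ z ≠ 0 := by
  intro h
  have h0 (j : Fin n) : dZ n (cR n ρ) j z = 0 := by
    have := (Finset.sum_eq_zero_iff_of_nonneg fun j _ => normSq_nonneg _).1 h j (Finset.mem_univ j)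
    exact normSq_eq_zero.1 this
  have h1 (j : Fin n) : dZb n (cR n ρ) j z = 0 := by rw [dZb_cR, h0, map_zero]
  have hre : fderiv ℝ (cR n ρ) z = Complex.ofRealCLM.comp (fderiv ℝ ρ z) :=
    (Complex.ofRealCLM.hasFDerivAt.comp z hρ.hasFDerivAt).fderiv
  apply hd
  ext u
  have hu : fderiv ℝ (cR n ρ) z u = 0 := by
    rw [fderiv_apply_eq_sum]
    refine Finset.sum_eq_zero fun j _ => ?_
    have e0 := h0 j
    have e1 := h1 j
    rw [dZ] at e0
    rw [dZb] at e1
    have e2 : fderiv ℝ (cR n ρ) z (Pi.single j 1) = 0 := by linear_combination e0 + e1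
    have e3 : fderiv ℝ (cR n ρ) z (Pi.single j I) = 0 := by
      linear_combination I * e0 - I * e1 +
        fderiv ℝ (cR n ρ) z (Pi.single j I) * I_sq
    rw [e2, e3]
    ring
  rw [hre] at hu
  simpa using hu

lemma eq_zero_of_mem_frontier {n : ℕ} {s : ℕ∞} {Ω V : Set (Pt n)} {ρ : Pt n → ℝ}
    (hdef : IsDefining n s Ω ρ V) {p : Pt n} (hp : p ∈ frontier Ω) : ρ p = 0 := by
  obtain ⟨hV, hcl, hC, hΩ, -⟩ := hdef
  have hpV : p ∈ V := hcl hp.1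
  have hcont : ContinuousAt ρ p := hC.continuousOn.continuousAt (hV.mem_nhds hpV)
  refine le_antisymm ?_ ?_
  · by_contra! h
    have hev : ∀ᶠ w in nhds p, 0 < ρ w := hcont.eventually (lt_mem_nhds h)
    obtain ⟨w, hw, hwΩ⟩ := mem_closure_iff_nhds.1 hp.1 _ hev
    rw [hΩ] at hwΩ
    exact absurd hwΩ.2 (not_lt.2 (le_of_lt hw))
  · by_contra! h
    have hev : ∀ᶠ w in nhds p, ρ w < 0 := hcont.eventually (gt_mem_nhds h)
    apply hp.2
    rw [mem_interior_iff_mem_nhds, hΩ]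
    filter_upwards [hV.mem_nhds hpV, hev] with w h1 h2 using ⟨h1, h2⟩

lemma eventually_mem_frontier {n : ℕ} {s : ℕ∞} (hs : 1 ≤ s) {Ω V : Set (Pt n)} {ρ : Pt n → ℝ}
    (hdef : IsDefining n s Ω ρ V) {p : Pt n} (hp : p ∈ frontier Ω) :
    ∀ᶠ w in nhds p, ρ w = 0 → w ∈ frontier Ω := by
  obtain ⟨hV, hcl, hC, hΩ, hne⟩ := hdef
  have hpV : V ∈ nhds p := hV.mem_nhds (hcl hp.1)
  have hCp : ContDiffAt ℝ 1 ρ p := (hC.contDiffAt hpV).of_le (by exact_mod_cast hs)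
  have hcont : ContinuousAt (fderiv ℝ ρ) p :=
    (hCp.fderiv_right (m := 0) (by norm_num)).continuousAt
  filter_upwards [hcont.eventually_ne (hne p hp), hpV] with w hw hwV hw0
  refine ⟨?_, fun h => ?_⟩
  · by_contra hcw
    apply hw
    refine IsLocalMin.fderiv_eq_zero ?_
    filter_upwards [isClosed_closure.isOpen_compl.mem_nhds hcw, hV.mem_nhds hwV] with x hx hxV
    rw [hw0]
    by_contra! hlt
    exact hx (subset_closure (by rw [hΩ]; exact ⟨hxV, hlt⟩))
  · have := interior_subset h
    rw [hΩ] at this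
    exact absurd this.2 (by rw [hw0]; exact lt_irrefl 0)


/-- Proposition 3.2, Boas–Straube: the exterior derivative of the
D'Angelo 1-form vanishes on Null_p ⊕ conj(Null_p) at every boundary point p. -/
theorem d_dAngelo_vanishes_on_null
    (n k : ℕ) (hn : 2 ≤ n) (hk : 3 ≤ k)
    (Ω : Set (Pt n)) (hopen : IsOpen Ω) (hconn : IsConnected Ω)
    (hbdd : Bornology.IsBounded Ω)
    (ρ : Pt n → ℝ) (V : Set (Pt n)) (hdef : IsDefining n (k : ℕ∞) Ω ρ V)
    (hpsc : LeviPseudoconvex n ρ Ω)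
    (p : Pt n) (hp : p ∈ frontier Ω) :
    ∀ A ∈ nullSp n ρ p, ∀ B ∈ nullSp n ρ p, ∀ A' ∈ nullSp n ρ p, ∀ B' ∈ nullSp n ρ p,
      dEval (dAngelo n ρ) (A, conjVec B) (A', conjVec B') p = 0 := by
  intro A hA B hB A' hA' B' hB'
  have hpV : V ∈ nhds p := hdef.1.mem_nhds (hdef.2.1 hp.1)
  have hC : ContDiffAt ℝ (3 : ℕ) ρ p :=
    (hdef.2.2.1.contDiffAt hpV).of_le (WithTop.coe_le_coe.2 (by exact_mod_cast hk))
  have hρ : ContDiffAt ℝ 1 ρ p := hC.of_le (by norm_num)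
  have hd : fderiv ℝ ρ p ≠ 0 := hdef.2.2.2.2 p hp
  have hreg : IsRegularAt n ρ p :=
    ⟨Complex.ofRealCLM.contDiff.contDiffAt.comp p hC,
      gradSq_ne_zero (hρ.differentiableAt one_ne_zero) hd⟩
  have hlev : ∀ᶠ w in nhds p, ρ w = ρ p → ∀ X ∈ T10 n ρ w, 0 ≤ (levi n ρ w X X).re := by
    rw [eq_zero_of_mem_frontier hdef hp]
    have hk1 : (1 : ℕ∞) ≤ k := by exact_mod_cast le_trans (by norm_num) hk
    filter_upwards [eventually_mem_frontier hk1 hdef hp] with w hw h0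
    exact hpsc w (hw h0)
  have h1 := sum_dZ_dAngelo_w_comm hreg hA hA'
  have h2 := sum_dZb_dAngelo_t_comm hreg hB hB'
  have h3 := sum_dZ_dAngelo_t_sub hreg hA hB'
  have h4 := sum_dZ_dAngelo_t_sub hreg hA' hB
  rw [lieLevi_eq_zero hreg hρ hd hlev hA hB'] at h3
  rw [lieLevi_eq_zero hreg hρ hd hlev hA' hB] at h4
  simp only [dEval, delEval, delbEval, mul_sub, Finset.sum_sub_distrib]
  linear_combination h1 + h2 + h3 - h4
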